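/- Let A be a nonzero real n×p matrix, μ_max the largest eigenvalue of AAᵀ, μ_min the smallest positive eigenvalue of AAᵀ, and 𝒮(A) = Sp(AᵀA) ∪ Sp(AAᵀ). Let η satisfy 1/(2√μ_max) ≤ η < 1/√(3·μ_max) and 1/(4η²) ∉ 𝒮(A). Let (x_t, y_t) be the OGDA sequence with step η and initialization (x₀, y₀, x₋₁, y₋₁), with limit (x_∞, y_∞) (the orthogonal projections of x₀ onto Ker(Aᵀ) and y₀ onto Ker(A)), and let D be the distance from the initialization to {(x, y, x, y) : Aᵀx = 0, Ay = 0}. Define λ* = 1_{μ_min ≤ 1/(4η²)} · √(½(1 + √(1 − 4η²μ_min))), λ** = 1_{μ_max ≥ 1/(4η²)} · √(2η²μ_max + η√μ_max · √(4η²μ_max − 1)), λ_max = max{λ*, λ**}, μ* = max{μ ∈ 𝒮(A) : η√μ < 1/2}, μ** = min{μ ∈ 𝒮(A) : η√μ > 1/2}, and C = max{ 1_{μ_min < 1/(4η²)} √(2/(1 − √((1 + 5η²μ*)/(2 + η²μ*)))), 1_{μ_max > 1/(4η²)} √(2/(1 − √((2 + η²μ**)/(1 + 5η²μ**)))) }.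 Then for all t ≥ 0, ‖(x_t, y_t) − (x_∞, y_∞)‖ ≤ C · D · λ_max^t. -/

import Mathlib

open Matrix Filter

noncomputable section

/-- Squared Euclidean norm of a vector in `ℝ^n`. -/
def sqnorm {n : ℕ} (v : Fin n → ℝ) : ℝ := ∑ i, (v i) ^ 2

/-- The set `𝒮(A) = Sp(AᵀA) ∪ Sp(AAᵀ)` of (real) eigenvalues. -/
def specS {n p : ℕ} (A : Matrix (Fin n) (Fin p) ℝ) : Set ℝ :=
  spectrum ℝ (Aᵀ * A) ∪ spectrum ℝ (A * Aᵀ)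

/-- A two-term linear recurrence with distinct characteristic roots `a`, `b` of squared modulus at
most `R` grows at most like `R ^ t`, with a constant governed by the cosine `r` of the angle between
the eigenvectors `(a, 1)` and `(b, 1)` of its companion matrix. -/
theorem normSq_le_of_two_roots {a b : ℂ} (hab : a ≠ b) {r R : ℝ} (hr0 : 0 ≤ r) (hr1 : r < 1)
    (hr : Complex.normSq (a * star b + 1) =
      r ^ 2 * ((1 + Complex.normSq a) * (1 + Complex.normSq b)))
    (ha : Complex.normSq a ≤ R) (hb : Complex.normSq b ≤ R) {c : ℕ → ℂ}
    (hc : ∀ t, c (t + 2) = (a + b) * c (t + 1) - a * b * c t) (t : ℕ) :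
    Complex.normSq (c (t + 1)) ≤
      2 / (1 - r) * R ^ t * (Complex.normSq (c 1) + Complex.normSq (c 0)) := by
  have hab' : a - b ≠ 0 := sub_ne_zero.2 hab
  obtain ⟨α, β, h0, h1⟩ : ∃ α β : ℂ, c 0 = α + β ∧ c 1 = α * a + β * b :=
    ⟨(c 1 - b * c 0) / (a - b), (a * c 0 - c 1) / (a - b),
      by field_simp; ring, by field_simp; ring⟩
  have hsol : ∀ t, c t = α * a ^ t + β * b ^ t ∧
      c (t + 1) = α * a ^ (t + 1) + β * b ^ (t + 1) := by
    intro t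
    induction t with
    | zero => simp [h0, h1]
    | succ t ih =>
      refine ⟨ih.2, ?_⟩
      rw [hc, ih.1, ih.2]
      ring
  have hR : 0 ≤ R := (Complex.normSq_nonneg a).trans ha
  have hNa : 0 ≤ 1 + Complex.normSq a := by linarith [Complex.normSq_nonneg a]
  have hNb : 0 ≤ 1 + Complex.normSq b := by linarith [Complex.normSq_nonneg b]
  set P := Complex.normSq α * (1 + Complex.normSq a) with hP
  set Q := Complex.normSq β * (1 + Complex.normSq b) with hQ
  have hP0 : 0 ≤ P := mul_nonneg (Complex.normSq_nonneg _) hNa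
  have hQ0 : 0 ≤ Q := mul_nonneg (Complex.normSq_nonneg _) hNb
  have hexp : Complex.normSq (c 1) + Complex.normSq (c 0) =
      P + Q + 2 * (α * star β * (a * star b + 1)).re := by
    rw [h0, h1, hP, hQ]
    simp [Complex.normSq_apply]
    ring
  have hcross : |(α * star β * (a * star b + 1)).re| ≤ r * ((P + Q) / 2) := by
    refine abs_le_of_sq_le_sq ?_ (by positivity)
    have h := Complex.re_sq_le_normSq (α * star β * (a * star b + 1))
    have hn : Complex.normSq (α * star β * (a * star b + 1)) = r ^ 2 * (P * Q) := by
      rw [map_mul, hr, map_mul, Complex.star_def, Complex.normSq_conj, hP, hQ]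
      ring
    nlinarith [mul_nonneg (sq_nonneg r) (sq_nonneg (P - Q))]
  have hlow : (1 - r) * (P + Q) ≤ Complex.normSq (c 1) + Complex.normSq (c 0) := by
    rw [hexp]
    linarith [(abs_le.1 hcross).1]
  have hpow : ∀ z w : ℂ, Complex.normSq z ≤ R →
      Complex.normSq (w * z ^ (t + 1)) ≤ Complex.normSq w * (1 + Complex.normSq z) * R ^ t := by
    intro z w hz
    have hz0 := Complex.normSq_nonneg z
    have hw0 := Complex.normSq_nonneg w
    rw [map_mul, map_pow, pow_succ', mul_assoc]
    gcongr
    linarith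
  have hup : Complex.normSq (c (t + 1)) ≤ 2 * (P + Q) * R ^ t := by
    rw [(hsol t).2]
    have h2 : ∀ z w : ℂ, Complex.normSq (z + w) ≤
        2 * (Complex.normSq z + Complex.normSq w) := by
      intro z w
      simp only [Complex.normSq_apply, Complex.add_re, Complex.add_im]
      nlinarith [sq_nonneg (z.re - w.re), sq_nonneg (z.im - w.im)]
    linarith [h2 (α * a ^ (t + 1)) (β * b ^ (t + 1)), hpow a α ha, hpow b β hb]
  refine hup.trans ?_
  have h1r : 0 < 1 - r := by linarith
  rw [div_mul_eq_mul_div, div_mul_eq_mul_div, le_div_iff₀ h1r]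
  have := mul_le_mul_of_nonneg_left hlow (pow_nonneg hR t)
  linarith

/-- Scalar OGDA with coupling `s`, in the regime of a positive discriminant. -/
theorem normSq_ogda_le_of_small {s : ℝ} (hs : 4 * s ^ 2 < 1) {c : ℕ → ℂ}
    (hc : ∀ t, c (t + 2) = (1 - 2 * Complex.I * s) * c (t + 1) + Complex.I * s * c t) (t : ℕ) :
    Complex.normSq (c (t + 1)) ≤ 2 / (1 - √((1 + 5 * s ^ 2) / (2 + s ^ 2))) *
      ((1 + √(1 - 4 * s ^ 2)) / 2) ^ t * (Complex.normSq (c 1) + Complex.normSq (c 0)) := by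
  have hq := Real.sq_sqrt (show 0 ≤ 1 - 4 * s ^ 2 by linarith)
  have hq0 := Real.sqrt_pos.2 (show 0 < 1 - 4 * s ^ 2 by linarith)
  set q := √(1 - 4 * s ^ 2)
  have hN : Complex.normSq ⟨(1 + q) / 2, -s⟩ = (1 + q) / 2 := by
    simp only [Complex.normSq_mk]; linear_combination hq / 4
  have hN' : Complex.normSq ⟨(1 - q) / 2, -s⟩ = (1 - q) / 2 := by
    simp only [Complex.normSq_mk]; linear_combination hq / 4
  refine normSq_le_of_two_roots (a := ⟨(1 + q) / 2, -s⟩) (b := ⟨(1 - q) / 2, -s⟩) ?_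
    (Real.sqrt_nonneg _) ?_ ?_ hN.le (by rw [hN']; linarith) ?_ t
  · intro h
    have := congrArg Complex.re h
    simp only at this
    linarith
  · rw [Real.sqrt_lt' one_pos, one_pow, div_lt_one (by positivity)]
    linarith
  · rw [Real.sq_sqrt (by positivity), hN, hN']
    have : (1 + (1 + q) / 2) * (1 + (1 - q) / 2) = 2 + s ^ 2 := by linear_combination -hq / 4
    rw [this, div_mul_cancel₀ _ (by positivity)]
    simp [Complex.normSq_apply]
    linear_combination (q ^ 2 + 4 * s ^ 2 - 9) / 16 * hq
  · intro t
    have hsum : (⟨(1 + q) / 2, -s⟩ : ℂ) + ⟨(1 - q) / 2, -s⟩ = 1 - 2 * Complex.I * s := by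
      apply Complex.ext <;> simp <;> ring
    have hprod : (⟨(1 + q) / 2, -s⟩ : ℂ) * ⟨(1 - q) / 2, -s⟩ = -(Complex.I * s) := by
      apply Complex.ext <;> simp <;> linarith
    rw [hc, hsum, hprod]
    ring

/-- Scalar OGDA with coupling `s`, in the regime of a negative discriminant. -/
theorem normSq_ogda_le_of_large {s : ℝ} (hs : 1 < 4 * s ^ 2) {c : ℕ → ℂ}
    (hc : ∀ t, c (t + 2) = (1 - 2 * Complex.I * s) * c (t + 1) + Complex.I * s * c t) (t : ℕ) :
    Complex.normSq (c (t + 1)) ≤ 2 / (1 - √((2 + s ^ 2) / (1 + 5 * s ^ 2))) *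
      (2 * s ^ 2 + |s| * √(4 * s ^ 2 - 1)) ^ t *
        (Complex.normSq (c 1) + Complex.normSq (c 0)) := by
  have hq := Real.sq_sqrt (show 0 ≤ 4 * s ^ 2 - 1 by linarith)
  have hq0 := Real.sqrt_pos.2 (show 0 < 4 * s ^ 2 - 1 by linarith)
  set q := √(4 * s ^ 2 - 1)
  have hN : Complex.normSq ⟨1 / 2, -(s + q / 2)⟩ = 2 * s ^ 2 + s * q := by
    simp only [Complex.normSq_mk]; linear_combination hq / 4
  have hN' : Complex.normSq ⟨1 / 2, -(s - q / 2)⟩ = 2 * s ^ 2 - s * q := by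
    simp only [Complex.normSq_mk]; linear_combination hq / 4
  refine normSq_le_of_two_roots (a := ⟨1 / 2, -(s + q / 2)⟩) (b := ⟨1 / 2, -(s - q / 2)⟩) ?_
    (Real.sqrt_nonneg _) ?_ ?_ ?_ ?_ ?_ t
  · intro h
    have := congrArg Complex.im h
    simp only at this
    linarith
  · rw [Real.sqrt_lt' one_pos, one_pow, div_lt_one (by positivity)]
    linarith
  · rw [Real.sq_sqrt (by positivity), hN, hN']
    have : (1 + (2 * s ^ 2 + s * q)) * (1 + (2 * s ^ 2 - s * q)) = 1 + 5 * s ^ 2 := by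
      linear_combination -s ^ 2 * hq
    rw [this, div_mul_cancel₀ _ (by positivity)]
    simp [Complex.normSq_apply]
    linear_combination (q ^ 2 - 4 * s ^ 2 - 7) / 16 * hq
  · rw [hN]
    have := mul_le_mul_of_nonneg_right (le_abs_self s) hq0.le
    linarith
  · rw [hN']
    have := mul_le_mul_of_nonneg_right (neg_le_abs s) hq0.le
    linarith
  · intro t
    have hsum : (⟨1 / 2, -(s + q / 2)⟩ : ℂ) + ⟨1 / 2, -(s - q / 2)⟩ = 1 - 2 * Complex.I * s := by
      apply Complex.ext <;> simp <;> ring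
    have hprod : (⟨1 / 2, -(s + q / 2)⟩ : ℂ) * ⟨1 / 2, -(s - q / 2)⟩ = -(Complex.I * s) := by
      apply Complex.ext <;> simp <;> linarith
    rw [hc, hsum, hprod]
    ring

theorem sqnorm_nonneg {n : ℕ} (v : Fin n → ℝ) : 0 ≤ sqnorm v :=
  Finset.sum_nonneg fun _ _ => sq_nonneg _

theorem sq_apply_le_sqnorm {n : ℕ} (v : Fin n → ℝ) (i : Fin n) : v i ^ 2 ≤ sqnorm v :=
  Finset.single_le_sum (f := fun i => v i ^ 2) (fun _ _ => sq_nonneg _) (Finset.mem_univ i)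

/-- Spectral theorem for real symmetric matrices, in coordinates. -/
theorem exists_eigenvector_parseval {ι : Type*} [Fintype ι] [DecidableEq ι] {K : Matrix ι ι ℝ}
    (hK : K.IsHermitian) :
    ∃ (e : ι → ι → ℝ) (σ : ι → ℝ), (∀ k, K *ᵥ e k = σ k • e k) ∧ (∀ k, e k ≠ 0) ∧
      ∀ v, ∑ k, (e k ⬝ᵥ v) ^ 2 = v ⬝ᵥ v := by
  refine ⟨fun k => hK.eigenvectorBasis k, hK.eigenvalues, hK.mulVec_eigenvectorBasis,
    fun k hk => ?_, fun v => ?_⟩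
  · apply hK.eigenvectorBasis.orthonormal.ne_zero k
    ext i
    exact congrFun hk i
  · have h := hK.eigenvectorBasis.sum_sq_norm_inner_right (WithLp.toLp 2 v)
    rw [EuclideanSpace.real_norm_sq_eq] at h
    simp only [Real.norm_eq_abs, sq_abs, EuclideanSpace.inner_eq_star_dotProduct] at h
    simpa [dotProduct, sq, mul_comm] using h

/-- Singular vectors of `A`, as the eigenvectors of the symmetric dilation of `A`. -/
theorem exists_singular_parseval {n p : ℕ} (A : Matrix (Fin n) (Fin p) ℝ) :
    ∃ (u : Fin n ⊕ Fin p → Fin n → ℝ) (v : Fin n ⊕ Fin p → Fin p → ℝ) (σ : Fin n ⊕ Fin p → ℝ),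
      (∀ k, A *ᵥ v k = σ k • u k) ∧ (∀ k, Aᵀ *ᵥ u k = σ k • v k) ∧
      (∀ k, u k ≠ 0 ∨ v k ≠ 0) ∧
      (∀ a, ∑ k, (u k ⬝ᵥ a) ^ 2 = sqnorm a) ∧ ∀ b, ∑ k, (v k ⬝ᵥ b) ^ 2 = sqnorm b := by
  have hK : (fromBlocks 0 A Aᵀ 0).IsHermitian := by
    rw [IsHermitian, fromBlocks_conjTranspose]
    simp [conjTranspose_eq_transpose_of_trivial]
  obtain ⟨e, σ, he, hne, hP⟩ := exists_eigenvector_parseval hK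
  have hsplit : ∀ k, A *ᵥ (e k ∘ Sum.inr) = σ k • (e k ∘ Sum.inl) ∧
      Aᵀ *ᵥ (e k ∘ Sum.inl) = σ k • (e k ∘ Sum.inr) := by
    intro k
    have h := he k
    rw [fromBlocks_mulVec] at h
    constructor
    · ext i
      simpa using congrFun h (Sum.inl i)
    · ext i
      simpa using congrFun h (Sum.inr i)
  refine ⟨fun k => e k ∘ Sum.inl, fun k => e k ∘ Sum.inr, σ, fun k => (hsplit k).1,
    fun k => (hsplit k).2, fun k => ?_, fun a => ?_, fun b => ?_⟩
  · by_contra! h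
    apply hne k
    ext (i | i)
    · exact congrFun h.1 i
    · exact congrFun h.2 i
  · simpa [dotProduct, sqnorm, sq] using hP (Sum.elim a 0)
  · simpa [dotProduct, sqnorm, sq] using hP (Sum.elim 0 b)

theorem exists_orthogonal_projection_ker {m q : ℕ} (B : Matrix (Fin m) (Fin q) ℝ)
    (x : Fin q → ℝ) :
    ∃ z, B *ᵥ z = 0 ∧ ∀ w, B *ᵥ w = 0 → (x - z) ⬝ᵥ w = 0 := by
  let S : Submodule ℝ (EuclideanSpace ℝ (Fin q)) := LinearMap.ker (toEuclideanLin B)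
  have hS : ∀ z : EuclideanSpace ℝ (Fin q), z ∈ S ↔ B *ᵥ z.ofLp = 0 := by
    intro z
    simp only [S, LinearMap.mem_ker]
    constructor
    · intro h
      have := congrArg WithLp.ofLp h
      simpa using this
    · intro h
      apply WithLp.ofLp_injective
      simpa using h
  refine ⟨(S.starProjection (WithLp.toLp 2 x)).ofLp,
    (hS _).1 (S.starProjection_apply_mem _), fun w hw => ?_⟩
  have h := S.starProjection_inner_eq_zero (WithLp.toLp 2 x) (WithLp.toLp 2 w) ((hS _).2 hw)
  rw [EuclideanSpace.inner_eq_star_dotProduct] at h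
  simpa [dotProduct_comm] using h

theorem dotProduct_mulVec_of_transpose_mulVec {n p : ℕ} {A : Matrix (Fin n) (Fin p) ℝ}
    {u : Fin n → ℝ} {v : Fin p → ℝ} {σ : ℝ} (h : Aᵀ *ᵥ u = σ • v) (w : Fin p → ℝ) :
    u ⬝ᵥ A *ᵥ w = σ * (v ⬝ᵥ w) := by
  rw [dotProduct_mulVec, ← mulVec_transpose, h, smul_dotProduct, smul_eq_mul]

theorem sq_mem_spectrum_of_singular {n p : ℕ} {A : Matrix (Fin n) (Fin p) ℝ}
    {u : Fin n → ℝ} {v : Fin p → ℝ} {σ : ℝ} (hσ : σ ≠ 0) (hv : A *ᵥ v = σ • u)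
    (hu : Aᵀ *ᵥ u = σ • v) (huv : u ≠ 0 ∨ v ≠ 0) : σ ^ 2 ∈ spectrum ℝ (A * Aᵀ) := by
  have hu0 : u ≠ 0 := by
    rintro rfl
    rw [mulVec_zero] at hu
    exact (huv.resolve_left (by simp)) ((smul_eq_zero.1 hu.symm).resolve_left hσ)
  rw [← Matrix.spectrum_toLin']
  refine Module.End.HasEigenvalue.mem_spectrum
    (Module.End.hasEigenvalue_of_hasEigenvector (x := u) ⟨?_, hu0⟩)
  rw [Module.End.mem_eigenspace_iff, toLin'_apply, ← mulVec_mulVec, hu, mulVec_smul, hv,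
    smul_smul, sq]

/-- If every scalar mode of zero-sum OGDA contracts like `M * L ^ t`, so does the distance of the
iterates to their limit, relative to any stationary point. -/
theorem sqnorm_ogda_sub_le {n p : ℕ} {A : Matrix (Fin n) (Fin p) ℝ} {η L M : ℝ} (hL : 0 ≤ L)
    (hM : 0 ≤ M)
    (hmode : ∀ σ : ℝ, σ ≠ 0 → σ ^ 2 ∈ spectrum ℝ (A * Aᵀ) → ∀ c : ℕ → ℂ,
      (∀ t, c (t + 2) = (1 - 2 * Complex.I * (η * σ : ℝ)) * c (t + 1) +
        Complex.I * (η * σ : ℝ) * c t) →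
      ∀ t, Complex.normSq (c (t + 1)) ≤
        M * L ^ t * (Complex.normSq (c 1) + Complex.normSq (c 0)))
    {X : ℕ → Fin n → ℝ} {Y : ℕ → Fin p → ℝ}
    (hX : ∀ t, X (t + 2) = X (t + 1) + (2 * η) • (A *ᵥ Y (t + 1)) - η • (A *ᵥ Y t))
    (hY : ∀ t, Y (t + 2) = Y (t + 1) - (2 * η) • (Aᵀ *ᵥ X (t + 1)) + η • (Aᵀ *ᵥ X t))
    {xinf xs : Fin n → ℝ} {yinf ys : Fin p → ℝ}
    (hxinf : Aᵀ *ᵥ xinf = 0) (hyinf : A *ᵥ yinf = 0)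
    (hxo : ∀ x', Aᵀ *ᵥ x' = 0 → (X 1 - xinf) ⬝ᵥ x' = 0)
    (hyo : ∀ y', A *ᵥ y' = 0 → (Y 1 - yinf) ⬝ᵥ y' = 0)
    (hxs : Aᵀ *ᵥ xs = 0) (hys : A *ᵥ ys = 0) (t : ℕ) :
    sqnorm (X (t + 1) - xinf) + sqnorm (Y (t + 1) - yinf) ≤ M * L ^ t *
      (sqnorm (X 1 - xs) + sqnorm (Y 1 - ys) + sqnorm (X 0 - xs) + sqnorm (Y 0 - ys)) := by
  obtain ⟨u, v, σ, hv, hu, huv, hPu, hPv⟩ := exists_singular_parseval A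
  simp only [← hPu, ← hPv, ← Finset.sum_add_distrib, Finset.mul_sum]
  refine Finset.sum_le_sum fun k _ => ?_
  have huA := dotProduct_mulVec_of_transpose_mulVec (hu k)
  have hvA := dotProduct_mulVec_of_transpose_mulVec (A := Aᵀ) (by simpa using hv k)
  have huX : ∀ t, u k ⬝ᵥ X (t + 2) = u k ⬝ᵥ X (t + 1) + 2 * η * (σ k * (v k ⬝ᵥ Y (t + 1))) -
      η * (σ k * (v k ⬝ᵥ Y t)) := by
    intro t
    rw [hX]
    simp [huA, dotProduct_add, dotProduct_sub]
  have hvY : ∀ t, v k ⬝ᵥ Y (t + 2) = v k ⬝ᵥ Y (t + 1) - 2 * η * (σ k * (u k ⬝ᵥ X (t + 1))) +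
      η * (σ k * (u k ⬝ᵥ X t)) := by
    intro t
    rw [hY]
    simp [hvA, dotProduct_add, dotProduct_sub]
  by_cases hσ : σ k = 0
  · have hconst : u k ⬝ᵥ X (t + 1) = u k ⬝ᵥ X 1 ∧ v k ⬝ᵥ Y (t + 1) = v k ⬝ᵥ Y 1 := by
      induction t with
      | zero => simp
      | succ t ih => simpa [huX, hvY, hσ] using ih
    have h1 := hxo (u k) (by rw [hu, hσ, zero_smul])
    have h2 := hyo (v k) (by rw [hv, hσ, zero_smul])
    rw [dotProduct_comm, dotProduct_sub] at h1 h2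
    simp only [dotProduct_sub (u k) (X (t + 1)), dotProduct_sub (v k) (Y (t + 1)), hconst.1,
      hconst.2, h1, h2]
    rw [zero_pow two_ne_zero, add_zero]
    positivity
  · have hu0 : ∀ w, Aᵀ *ᵥ w = 0 → u k ⬝ᵥ w = 0 := by
      intro w hw
      have := hvA w
      rw [hw, dotProduct_zero, eq_comm, mul_eq_zero] at this
      exact this.resolve_left hσ
    have hv0 : ∀ w, A *ᵥ w = 0 → v k ⬝ᵥ w = 0 := by
      intro w hw
      have := huA w
      rw [hw, dotProduct_zero, eq_comm, mul_eq_zero] at this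
      exact this.resolve_left hσ
    have h := hmode (σ k) hσ (sq_mem_spectrum_of_singular hσ (hv k) (hu k) (huv k))
      (fun t => ⟨u k ⬝ᵥ X t, v k ⬝ᵥ Y t⟩)
      (fun t => by apply Complex.ext <;> simp [huX, hvY] <;> ring) t
    simp only [Complex.normSq_mk] at h
    simp only [dotProduct_sub, hu0 _ hxinf, hu0 _ hxs, hv0 _ hyinf, hv0 _ hys, sub_zero]
    calc _ = _ := by simp only [sq]
      _ ≤ _ := h
      _ = _ := by ring

theorem mul_sqrt_lt_half_iff {η μ : ℝ} (hη : 0 ≤ η) : η * √μ < 1 / 2 ↔ 4 * (η ^ 2 * μ) < 1 := by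
  rw [← Real.sqrt_sq hη, ← Real.sqrt_mul (sq_nonneg η), Real.sqrt_lt' (by norm_num),
    Real.sq_sqrt (sq_nonneg η)]
  constructor <;> intro h <;> linarith

theorem half_lt_mul_sqrt_iff {η μ : ℝ} (hη : 0 ≤ η) : 1 / 2 < η * √μ ↔ 1 < 4 * (η ^ 2 * μ) := by
  rw [← Real.sqrt_sq hη, ← Real.sqrt_mul (sq_nonneg η), Real.lt_sqrt (by norm_num),
    Real.sq_sqrt (sq_nonneg η)]
  constructor <;> intro h <;> linarith

theorem conditioning_le_of_small {a b : ℝ} (ha : 0 ≤ a) (hab : a ≤ b) (hb : 4 * b < 1) :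
    2 / (1 - √((1 + 5 * a) / (2 + a))) ≤ 2 / (1 - √((1 + 5 * b) / (2 + b))) := by
  have hb0 := ha.trans hab
  have hr1 : √((1 + 5 * b) / (2 + b)) < 1 := by
    rw [Real.sqrt_lt' one_pos, one_pow, div_lt_one (by positivity)]
    linarith
  have hr : √((1 + 5 * a) / (2 + a)) ≤ √((1 + 5 * b) / (2 + b)) := by
    apply Real.sqrt_le_sqrt
    rw [div_le_div_iff₀ (by positivity) (by positivity)]
    linarith
  exact div_le_div_of_nonneg_left zero_le_two (by linarith) (by linarith)

theorem conditioning_le_of_large {a b : ℝ} (hb : 1 < 4 * b) (hba : b ≤ a) :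
    2 / (1 - √((2 + a) / (1 + 5 * a))) ≤ 2 / (1 - √((2 + b) / (1 + 5 * b))) := by
  have hb0 : 0 < b := by linarith
  have ha0 := hb0.trans_le hba
  have hr1 : √((2 + b) / (1 + 5 * b)) < 1 := by
    rw [Real.sqrt_lt' one_pos, one_pow, div_lt_one (by positivity)]
    linarith
  have hr : √((2 + a) / (1 + 5 * a)) ≤ √((2 + b) / (1 + 5 * b)) := by
    apply Real.sqrt_le_sqrt
    rw [div_le_div_iff₀ (by positivity) (by positivity)]
    linarith
  exact div_le_div_of_nonneg_left zero_le_two (by linarith) (by linarith)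

/-- **Theorem (exponential convergence of zero-sum OGDA, large step size,
`1/(4η²) ∉ 𝒮(A)`).**  With `1/(2√μ_max) ≤ η < 1/√(3μ_max)` and `1/(4η²) ∉ 𝒮(A)`, the
OGDA iterates converge to the orthogonal projections `(x_∞, y_∞)` and for all `t`,
`‖(x_t,y_t) − (x_∞,y_∞)‖ ≤ C·D·λ_max^t` with the indicator-defined `λ_max`, `μ*`, `μ**`
and `C` of the paper. -/
theorem ogda_zero_sum_exponential_rate_large_step
    {n p : ℕ} (A : Matrix (Fin n) (Fin p) ℝ) (hA : A ≠ 0)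
    (μmax μmin : ℝ)
    (hμmax : IsGreatest (spectrum ℝ (A * Aᵀ)) μmax)
    (hμmin : IsLeast {μ ∈ spectrum ℝ (A * Aᵀ) | 0 < μ} μmin)
    (η : ℝ) (hη0 : 0 < η)
    (hη1 : 1 / (2 * Real.sqrt μmax) ≤ η) (hη2 : η < 1 / Real.sqrt (3 * μmax))
    (hnotin : 1 / (4 * η ^ 2) ∉ specS A)
    (lstar lstarstar lmax μstar μstarstar C : ℝ)
    (hlstar : lstar = if μmin ≤ 1 / (4 * η ^ 2) then
        Real.sqrt ((1 + Real.sqrt (1 - 4 * η^2 * μmin)) / 2) else 0)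
    (hlstarstar : lstarstar = if 1 / (4 * η ^ 2) ≤ μmax then
        Real.sqrt (2 * η^2 * μmax + η * Real.sqrt μmax * Real.sqrt (4 * η^2 * μmax - 1)) else 0)
    (hlmax : lmax = max lstar lstarstar)
    (hμstar : μstar = sSup {μ ∈ specS A | η * Real.sqrt μ < 1 / 2})
    (hμstarstar : μstarstar = sInf {μ ∈ specS A | 1 / 2 < η * Real.sqrt μ})
    (hC : C = max
      (if μmin < 1 / (4 * η ^ 2) then
        Real.sqrt (2 / (1 - Real.sqrt ((1 + 5 * η^2 * μstar) / (2 + η^2 * μstar)))) else 0)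
      (if 1 / (4 * η ^ 2) < μmax then
        Real.sqrt (2 / (1 - Real.sqrt ((2 + η^2 * μstarstar) / (1 + 5 * η^2 * μstarstar)))) else 0))
    (x : ℕ → Fin n → ℝ) (y : ℕ → Fin p → ℝ)
    (xm1 : Fin n → ℝ) (ym1 : Fin p → ℝ)
    (hx1 : x 1 = x 0 + (2 * η) • (A *ᵥ y 0) - η • (A *ᵥ ym1))
    (hy1 : y 1 = y 0 - (2 * η) • (Aᵀ *ᵥ x 0) + η • (Aᵀ *ᵥ xm1))
    (hx : ∀ t, x (t + 2) = x (t + 1) + (2 * η) • (A *ᵥ y (t + 1)) - η • (A *ᵥ y t))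
    (hy : ∀ t, y (t + 2) = y (t + 1) - (2 * η) • (Aᵀ *ᵥ x (t + 1)) + η • (Aᵀ *ᵥ x t))
    (D : ℝ)
    (hD : D = sInf {d : ℝ | ∃ (xs : Fin n → ℝ) (ys : Fin p → ℝ),
      Aᵀ *ᵥ xs = 0 ∧ A *ᵥ ys = 0 ∧
      d = Real.sqrt (sqnorm (x 0 - xs) + sqnorm (y 0 - ys) +
            sqnorm (xm1 - xs) + sqnorm (ym1 - ys))}) :
    ∃ (xinf : Fin n → ℝ) (yinf : Fin p → ℝ),
      Tendsto (fun t => (x t, y t)) atTop (nhds (xinf, yinf)) ∧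
      Aᵀ *ᵥ xinf = 0 ∧ A *ᵥ yinf = 0 ∧
      (∀ x' : Fin n → ℝ, Aᵀ *ᵥ x' = 0 → (x 0 - xinf) ⬝ᵥ x' = 0) ∧
      (∀ y' : Fin p → ℝ, A *ᵥ y' = 0 → (y 0 - yinf) ⬝ᵥ y' = 0) ∧
      ∀ t, Real.sqrt (sqnorm (x t - xinf) + sqnorm (y t - yinf)) ≤ C * D * lmax ^ t := by
  have hfin : (specS A).Finite := (Matrix.finite_spectrum _).union (Matrix.finite_spectrum _)
  have hmem : ∀ μ ∈ spectrum ℝ (A * Aᵀ), μ ∈ specS A := fun μ h => Or.inr h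
  have hmin0 : 0 < μmin := hμmin.1.2
  have hmax0 : 0 < μmax := hmin0.trans_le (hμmax.2 hμmin.1.1)
  have hη2pos : 0 < η ^ 2 := by positivity
  have h3 : η ^ 2 * μmax < 1 / 3 := by
    rw [lt_div_iff₀ (by positivity), ← Real.sqrt_sq hη0.le,
      ← Real.sqrt_mul (sq_nonneg η), Real.sqrt_lt' one_pos] at hη2
    linarith
  have hL0 : 0 ≤ lmax := by
    rw [hlmax, hlstar]
    refine le_max_of_le_left ?_
    split_ifs
    exacts [Real.sqrt_nonneg _, le_rfl]
  have hC0 : 0 ≤ C := by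
    rw [hC]
    refine le_max_of_le_left ?_
    split_ifs
    exacts [Real.sqrt_nonneg _, le_rfl]
  have hL1 : lmax < 1 := by
    rw [hlmax, hlstar, hlstarstar]
    refine max_lt ?_ ?_
    · split_ifs with h
      · rw [Real.sqrt_lt' one_pos]
        have : √(1 - 4 * η ^ 2 * μmin) < 1 := by
          rw [Real.sqrt_lt' one_pos]
          nlinarith
        linarith
      · exact one_pos
    · split_ifs with h
      · rw [Real.sqrt_lt' one_pos]
        have h1 : √(4 * η ^ 2 * μmax - 1) ≤ η * √μmax := by
          apply Real.sqrt_le_iff.2 ⟨by positivity, ?_⟩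
          rw [mul_pow, Real.sq_sqrt hmax0.le]
          linarith
        have h2 : 0 ≤ η * √μmax := by positivity
        have h4 : (η * √μmax) ^ 2 = η ^ 2 * μmax := by rw [mul_pow, Real.sq_sqrt hmax0.le]
        nlinarith
      · exact one_pos
  have hmode : ∀ σ : ℝ, σ ≠ 0 → σ ^ 2 ∈ spectrum ℝ (A * Aᵀ) → ∀ c : ℕ → ℂ,
      (∀ t, c (t + 2) = (1 - 2 * Complex.I * (η * σ : ℝ)) * c (t + 1) +
        Complex.I * (η * σ : ℝ) * c t) →
      ∀ t, Complex.normSq (c (t + 1)) ≤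
        C ^ 2 * (lmax ^ 2) ^ t * (Complex.normSq (c 1) + Complex.normSq (c 0)) := by
    intro σ hσ hspec c hc t
    have hσ2 : 0 < σ ^ 2 := by positivity
    have hle : σ ^ 2 ≤ μmax := hμmax.2 hspec
    have hge : μmin ≤ σ ^ 2 := hμmin.2 ⟨hspec, hσ2⟩
    have hns := add_nonneg (Complex.normSq_nonneg (c 1)) (Complex.normSq_nonneg (c 0))
    have hne : σ ^ 2 ≠ 1 / (4 * η ^ 2) := fun h => hnotin (h ▸ hmem _ hspec)
    rcases hne.lt_or_gt with hlt | hgt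
    · have hminlt : μmin < 1 / (4 * η ^ 2) := hge.trans_lt hlt
      rw [lt_div_iff₀ (by positivity)] at hlt
      have hs : 4 * (η * σ) ^ 2 < 1 := by linarith
      have hin : σ ^ 2 ∈ {μ ∈ specS A | η * √μ < 1 / 2} :=
        ⟨hmem _ hspec, (mul_sqrt_lt_half_iff hη0.le).2 (by linarith)⟩
      have hfin' : {μ ∈ specS A | η * √μ < 1 / 2}.Finite := hfin.sep _
      have hμs : σ ^ 2 ≤ μstar := hμstar ▸ le_csSup hfin'.bddAbove hin
      have hμs' : 4 * (η ^ 2 * μstar) < 1 := (mul_sqrt_lt_half_iff hη0.le).1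
        (hμstar ▸ Set.Nonempty.csSup_mem ⟨_, hin⟩ hfin').2
      refine (normSq_ogda_le_of_small hs hc t).trans ?_
      have hCle : 2 / (1 - √((1 + 5 * (η * σ) ^ 2) / (2 + (η * σ) ^ 2))) ≤ C ^ 2 := by
        rw [← Real.sqrt_le_left hC0, hC, if_pos hminlt]
        refine le_max_of_le_left (Real.sqrt_le_sqrt ?_)
        rw [mul_assoc 5, mul_pow]
        exact conditioning_le_of_small (by positivity)
          (mul_le_mul_of_nonneg_left hμs hη2pos.le) hμs'
      have hLle : (1 + √(1 - 4 * (η * σ) ^ 2)) / 2 ≤ lmax ^ 2 := by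
        rw [← Real.sqrt_le_left hL0, hlmax, hlstar, if_pos hminlt.le]
        refine le_max_of_le_left (Real.sqrt_le_sqrt ?_)
        gcongr ?_ / 2
        gcongr 1 + √?_
        nlinarith [mul_le_mul_of_nonneg_left hge hη2pos.le]
      gcongr
    · have hmaxlt : 1 / (4 * η ^ 2) < μmax := lt_of_lt_of_le hgt hle
      rw [div_lt_iff₀ (by positivity)] at hgt
      have hs : 1 < 4 * (η * σ) ^ 2 := by linarith
      have hin : σ ^ 2 ∈ {μ ∈ specS A | 1 / 2 < η * √μ} :=
        ⟨hmem _ hspec, (half_lt_mul_sqrt_iff hη0.le).2 (by linarith)⟩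
      have hfin' : {μ ∈ specS A | 1 / 2 < η * √μ}.Finite := hfin.sep _
      have hμs : μstarstar ≤ σ ^ 2 := hμstarstar ▸ csInf_le hfin'.bddBelow hin
      have hμs' : 1 < 4 * (η ^ 2 * μstarstar) := (half_lt_mul_sqrt_iff hη0.le).1
        (hμstarstar ▸ Set.Nonempty.csInf_mem ⟨_, hin⟩ hfin').2
      refine (normSq_ogda_le_of_large hs hc t).trans ?_
      have hCle : 2 / (1 - √((2 + (η * σ) ^ 2) / (1 + 5 * (η * σ) ^ 2))) ≤ C ^ 2 := by
        rw [← Real.sqrt_le_left hC0, hC, if_pos hmaxlt]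
        refine le_max_of_le_right (Real.sqrt_le_sqrt ?_)
        rw [mul_assoc 5, mul_pow]
        exact conditioning_le_of_large hμs' (mul_le_mul_of_nonneg_left hμs hη2pos.le)
      have hLle : 2 * (η * σ) ^ 2 + |η * σ| * √(4 * (η * σ) ^ 2 - 1) ≤ lmax ^ 2 := by
        rw [← Real.sqrt_le_left hL0, hlmax, hlstarstar, if_pos hmaxlt.le]
        refine le_max_of_le_right (Real.sqrt_le_sqrt ?_)
        rw [abs_mul, abs_of_pos hη0, ← Real.sqrt_sq_eq_abs σ, mul_pow, ← mul_assoc, ← mul_assoc]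
        gcongr
      gcongr
  obtain ⟨xinf, hxinf, hxo⟩ := exists_orthogonal_projection_ker Aᵀ (x 0)
  obtain ⟨yinf, hyinf, hyo⟩ := exists_orthogonal_projection_ker A (y 0)
  have hbound : ∀ t, √(sqnorm (x t - xinf) + sqnorm (y t - yinf)) ≤ C * D * lmax ^ t := by
    intro t
    have key : ∀ xs ys, Aᵀ *ᵥ xs = 0 → A *ᵥ ys = 0 →
        √(sqnorm (x t - xinf) + sqnorm (y t - yinf)) ≤ C * lmax ^ t *
          √(sqnorm (x 0 - xs) + sqnorm (y 0 - ys) + sqnorm (xm1 - xs) + sqnorm (ym1 - ys)) := by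
      intro xs ys hxs hys
      have h := sqnorm_ogda_sub_le (sq_nonneg lmax) (sq_nonneg C) hmode
        (X := fun t => Nat.casesOn t xm1 x) (Y := fun t => Nat.casesOn t ym1 y)
        (by rintro (_ | t); exacts [hx1, hx t]) (by rintro (_ | t); exacts [hy1, hy t])
        hxinf hyinf hxo hyo hxs hys t
      refine (Real.sqrt_le_sqrt h).trans_eq ?_
      rw [← pow_mul, mul_comm 2 t, pow_mul, ← mul_pow, Real.sqrt_mul (sq_nonneg _),
        Real.sqrt_sq (mul_nonneg hC0 (pow_nonneg hL0 t))]
      rfl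
    rw [mul_right_comm]
    rcases (mul_nonneg hC0 (pow_nonneg hL0 t)).eq_or_lt with h0 | h0
    · have := key 0 0 (mulVec_zero _) (mulVec_zero _)
      rwa [← h0, zero_mul] at this ⊢
    · rw [← div_le_iff₀' h0, hD]
      refine le_csInf ⟨_, 0, 0, mulVec_zero _, mulVec_zero _, rfl⟩ ?_
      rintro d ⟨xs, ys, hxs, hys, rfl⟩
      rw [div_le_iff₀' h0]
      exact key xs ys hxs hys
  have hlim : Tendsto (fun t => √(sqnorm (x t - xinf) + sqnorm (y t - yinf))) atTop (nhds 0) := by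
    refine squeeze_zero (fun _ => Real.sqrt_nonneg _) hbound ?_
    simpa using (tendsto_pow_atTop_nhds_zero_of_lt_one hL0 hL1).const_mul (C * D)
  refine ⟨xinf, yinf, ?_, hxinf, hyinf, hxo, hyo, hbound⟩
  refine Tendsto.prodMk_nhds (tendsto_pi_nhds.2 fun i => ?_) (tendsto_pi_nhds.2 fun i => ?_)
  · refine tendsto_iff_dist_tendsto_zero.2 (squeeze_zero (fun _ => dist_nonneg) (fun t => ?_) hlim)
    exact Real.abs_le_sqrt ((sq_apply_le_sqnorm (x t - xinf) i).trans
      (le_add_of_nonneg_right (sqnorm_nonneg _)))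
  · refine tendsto_iff_dist_tendsto_zero.2 (squeeze_zero (fun _ => dist_nonneg) (fun t => ?_) hlim)
    exact Real.abs_le_sqrt ((sq_apply_le_sqnorm (y t - yinf) i).trans
      (le_add_of_nonneg_left (sqnorm_nonneg _)))

end
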